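/- Let α be a positive integer and β, γ, q integers with gcd(α,β) = 1 and qβ ≡ 1 (mod α), and let ρ ∈ (0,1). Then ∑_{k=0}^{α−1} {(γ − kβ)/α} · (1 − 2{(k+ρ)/α}) = −ρ + {(qγ + ρ)/α} + 2·s(β, α; (γ + βρ)/α, −ρ). -/

import Mathlib

/-- The sawtooth function `((x))`: equal to `{x} - 1/2` for `x ∉ ℤ` and to `0` for `x ∈ ℤ`. -/
noncomputable def sawtooth (x : ℝ) : ℝ :=
  if Int.fract x = 0 then 0 else Int.fract x - 1 / 2

/-- The Dedekind–Rademacher sum `s(β, α; x, y) = ∑_{r=1}^α ((x + β(r+y)/α)) (((r+y)/α))`. -/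
noncomputable def drSum (b : ℤ) (a : ℕ) (x y : ℝ) : ℝ :=
  ∑ r ∈ Finset.Icc 1 a,
    sawtooth (x + (b : ℝ) * (((r : ℝ) + y) / (a : ℝ))) * sawtooth (((r : ℝ) + y) / (a : ℝ))

theorem sawtooth_add_intCast (x : ℝ) (n : ℤ) : sawtooth (x + n) = sawtooth x := by
  simp [sawtooth]

theorem sawtooth_neg (x : ℝ) : sawtooth (-x) = -sawtooth x := by
  unfold sawtooth
  by_cases h : Int.fract x = 0
  · simp [h, Int.fract_neg_eq_zero]
  · rw [if_neg h, if_neg (by rwa [Int.fract_neg_eq_zero]), Int.fract_neg h]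
    ring

theorem fract_eq_sawtooth_add (x : ℝ) :
    Int.fract x = sawtooth x + 1 / 2 - if Int.fract x = 0 then 1 / 2 else 0 := by
  unfold sawtooth
  split_ifs with h
  · rw [h]; ring
  · ring

theorem fract_intCast_div_natCast_eq_zero_iff {a : ℕ} (ha : 0 < a) (m : ℤ) :
    Int.fract ((m : ℝ) / (a : ℝ)) = 0 ↔ (a : ℤ) ∣ m := by
  have ha' : (a : ℝ) ≠ 0 := by positivity
  rw [Int.fract_eq_zero_iff]
  constructor
  · rintro ⟨z, hz⟩
    refine ⟨z, ?_⟩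
    rw [eq_div_iff ha'] at hz
    rw [mul_comm]
    exact_mod_cast hz.symm
  · rintro ⟨z, rfl⟩
    refine ⟨z, ?_⟩
    push_cast
    field_simp

theorem fract_natCast_add_div {a k : ℕ} (hk : k < a) {ρ : ℝ} (hρ : ρ ∈ Set.Ioo (0 : ℝ) 1) :
    Int.fract (((k : ℝ) + ρ) / (a : ℝ)) = ((k : ℝ) + ρ) / (a : ℝ) := by
  have ha : (0 : ℝ) < a := by exact_mod_cast (Nat.zero_le k).trans_lt hk
  have hk' : (k : ℝ) + 1 ≤ a := by exact_mod_cast hk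
  rw [Int.fract_eq_self]
  refine ⟨div_nonneg (add_nonneg k.cast_nonneg hρ.1.le) ha.le, ?_⟩
  rw [div_lt_one ha]
  linarith [hρ.2]

/-- Reversing the order of summation, `r = a - k`. -/
theorem two_mul_drSum_eq {a : ℕ} (ha : 0 < a) (b c : ℤ) {ρ : ℝ} (hρ : ρ ∈ Set.Ioo (0 : ℝ) 1) :
    2 * drSum b a (((c : ℝ) + (b : ℝ) * ρ) / (a : ℝ)) (-ρ) =
      ∑ k ∈ Finset.range a, sawtooth (((c : ℝ) - (k : ℝ) * (b : ℝ)) / (a : ℝ)) *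
        (1 - 2 * (((k : ℝ) + ρ) / (a : ℝ))) := by
  have ha' : (a : ℝ) ≠ 0 := by positivity
  rw [drSum, Finset.mul_sum]
  refine Finset.sum_bij' (fun r _ => a - r) (fun k _ => a - k) ?_ ?_ ?_ ?_ ?_
  · intro r hr
    rw [Finset.mem_Icc] at hr
    rw [Finset.mem_range]
    omega
  · intro k hk
    rw [Finset.mem_range] at hk
    rw [Finset.mem_Icc]
    omega
  · intro r hr
    rw [Finset.mem_Icc] at hr
    omega
  · intro k hk
    rw [Finset.mem_range] at hk
    omega
  · intro r hr
    rw [Finset.mem_Icc] at hr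
    obtain ⟨k, hk⟩ : ∃ k, k = a - r := ⟨_, rfl⟩
    have hka : k < a := by omega
    have hr' : (r : ℝ) = a - k := by
      rw [hk, Nat.cast_sub hr.2]
      ring
    rw [← hk, hr']
    have h1 : ((c : ℝ) + b * ρ) / a + b * (((a : ℝ) - k + -ρ) / a) =
        ((c : ℝ) - k * b) / a + b := by
      field_simp
      ring
    have h2 : ((a : ℝ) - k + -ρ) / a = -(((k : ℝ) + ρ) / a) + (1 : ℤ) := by
      push_cast
      field_simp
      ring
    have hpos : ((k : ℝ) + ρ) / a ≠ 0 :=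
      div_ne_zero (add_pos_of_nonneg_of_pos k.cast_nonneg hρ.1).ne' ha'
    rw [h1, h2, sawtooth_add_intCast, sawtooth_add_intCast, sawtooth_neg,
      sawtooth.eq_def (((k : ℝ) + ρ) / a), fract_natCast_add_div hka hρ, if_neg hpos]
    ring

theorem sum_one_sub_two_mul_natCast_add_div {a : ℕ} (ha : 0 < a) (ρ : ℝ) :
    ∑ k ∈ Finset.range a, (1 - 2 * (((k : ℝ) + ρ) / (a : ℝ))) = 1 - 2 * ρ := by
  have ha' : (a : ℝ) ≠ 0 := by positivity
  have h (n : ℕ) : ∑ k ∈ Finset.range n, (1 - 2 * (((k : ℝ) + ρ) / (a : ℝ))) =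
      n - (n * (n - 1) + 2 * n * ρ) / a := by
    induction n with
    | zero => simp
    | succ n ih =>
      rw [Finset.sum_range_succ, ih]
      push_cast
      field_simp
      ring
  rw [h]
  field_simp
  ring

/-- If `q` inverts `b` modulo `a`, the only `k ∈ [0, a)` with `a ∣ c - k b` is `q c mod a`. -/
theorem dvd_sub_natCast_mul_iff {a k : ℕ} (hk : k < a) {b q : ℤ} (c : ℤ)
    (hq : q * b ≡ 1 [ZMOD (a : ℤ)]) :
    (a : ℤ) ∣ c - k * b ↔ k = (q * c % a).toNat := by
  have ha : (a : ℤ) ≠ 0 := by omega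
  have hk' : (k : ℤ) % a = k := Int.emod_eq_of_lt (by omega) (by omega)
  have hnn : 0 ≤ q * c % a := Int.emod_nonneg _ ha
  have key : (k : ℤ) ≡ q * c [ZMOD a] ↔ k = (q * c % a).toNat := by
    rw [Int.ModEq, hk']
    omega
  rw [← key, ← Int.modEq_iff_dvd]
  constructor
  · intro h
    calc (k : ℤ) = k * 1 := by ring
      _ ≡ k * (q * b) [ZMOD a] := hq.symm.mul_left _
      _ = q * (k * b) := by ring
      _ ≡ q * c [ZMOD a] := h.mul_left _
  · intro h
    calc (k : ℤ) * b ≡ q * c * b [ZMOD a] := h.mul_right _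
      _ = c * (q * b) := by ring
      _ ≡ c * 1 [ZMOD a] := hq.mul_left _
      _ = c := by ring

/-- With `gcd(α, β) = 1`, `qβ ≡ 1 (mod α)` and `ρ ∈ (0,1)`:
`∑_{k=0}^{α-1} {(γ-kβ)/α} (1 - 2{(k+ρ)/α}) = -ρ + {(qγ+ρ)/α} + 2 s(β, α; (γ+βρ)/α, -ρ)`. -/
theorem fract_sum_eq_drSum
    (α : ℕ) (hα : 0 < α) (β γ q : ℤ)
    (hcop : Int.gcd (α : ℤ) β = 1) (hq : q * β ≡ 1 [ZMOD (α : ℤ)])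
    (ρ : ℝ) (hρ : ρ ∈ Set.Ioo (0 : ℝ) 1) :
    ∑ k ∈ Finset.range α,
        Int.fract (((γ : ℝ) - (k : ℝ) * (β : ℝ)) / (α : ℝ)) *
          (1 - 2 * Int.fract (((k : ℝ) + ρ) / (α : ℝ))) =
      -ρ + Int.fract (((q : ℝ) * (γ : ℝ) + ρ) / (α : ℝ)) +
        2 * drSum β α (((γ : ℝ) + (β : ℝ) * ρ) / (α : ℝ)) (-ρ) := by
  have hα' : (α : ℝ) ≠ 0 := by positivity
  have hαz : (0 : ℤ) < α := by exact_mod_cast hα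
  obtain ⟨m, hm⟩ : ∃ m, m = (q * γ % α).toNat := ⟨_, rfl⟩
  have hmz : (m : ℤ) = q * γ % α := by
    rw [hm, Int.toNat_of_nonneg (Int.emod_nonneg _ hαz.ne')]
  have hmα : m < α := by
    have := Int.emod_lt_of_pos (q * γ) hαz
    omega
  have hfract : Int.fract (((q : ℝ) * (γ : ℝ) + ρ) / (α : ℝ)) = ((m : ℝ) + ρ) / α := by
    have hdiv : (q : ℝ) * γ = m + α * ((q * γ / α : ℤ) : ℝ) := by
      have := Int.emod_add_mul_ediv (q * γ) α
      rw [← hmz] at this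
      exact_mod_cast this.symm
    have hsplit : ((q : ℝ) * γ + ρ) / α = ((m : ℝ) + ρ) / α + ((q * γ / α : ℤ) : ℝ) := by
      rw [hdiv]
      field_simp
      ring
    rw [hsplit, Int.fract_add_intCast, fract_natCast_add_div hmα hρ]
  have hterm : ∀ k ∈ Finset.range α,
      Int.fract (((γ : ℝ) - (k : ℝ) * (β : ℝ)) / (α : ℝ)) *
          (1 - 2 * Int.fract (((k : ℝ) + ρ) / (α : ℝ))) =
        sawtooth (((γ : ℝ) - (k : ℝ) * (β : ℝ)) / (α : ℝ)) *
            (1 - 2 * (((k : ℝ) + ρ) / (α : ℝ))) +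
          1 / 2 * (1 - 2 * (((k : ℝ) + ρ) / (α : ℝ))) -
          if k = m then 1 / 2 * (1 - 2 * (((k : ℝ) + ρ) / (α : ℝ))) else 0 := by
    intro k hk
    rw [Finset.mem_range] at hk
    have hiff : Int.fract (((γ : ℝ) - (k : ℝ) * (β : ℝ)) / (α : ℝ)) = 0 ↔ k = m := by
      rw [hm, ← dvd_sub_natCast_mul_iff hk γ hq, ← fract_intCast_div_natCast_eq_zero_iff hα]
      push_cast
      rfl
    rw [fract_natCast_add_div hk hρ, fract_eq_sawtooth_add]
    simp only [hiff]
    split_ifs <;> ring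
  rw [Finset.sum_congr rfl hterm, Finset.sum_sub_distrib, Finset.sum_add_distrib,
    ← Finset.mul_sum, sum_one_sub_two_mul_natCast_add_div hα, ← two_mul_drSum_eq hα β γ hρ,
    Finset.sum_ite_eq' (Finset.range α) m, if_pos (Finset.mem_range.mpr hmα), hfract]
  ring
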